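/- arXiv:2505.08308 — 2 statements merged into one kernel-verified Lean document; each statement's English description precedes it below -/
import Mathlib

section
/- There exist a constant C > 0 and an integer K such that for every integer k ≥ K, all nonnegative integers k₀, k₁ with k₀ + k₁ ≤ k, every real 0 ≤ β ≤ 1, and every integer n ≥ k⁴, there exists an (n, k₀, k₁, 1/√k, β)-mapping family of size at most C · binom(k₁, ⌈β·k₁⌉)⁻¹ · (√k)^{⌈β·k₁⌉} · e^{(k₀+k₁)/√k} · k⁸ · log k · log n. -/
open Finset

/-- An `(n,k₀,k₁,α,β)`-mapping family: every function maps exactly `⌈α·n⌉` elements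
to `1`, and for all disjoint `S₀, S₁ ⊆ [n]` with `|S₀| = k₀`, `|S₁| = k₁` some
function maps all of `S₀` to `0` and exactly `⌈β·k₁⌉` elements of `S₁` to `1`. -/
def IsMappingFamily (n k₀ k₁ : ℕ) (α β : ℝ) (F : Finset (Fin n → Fin 2)) : Prop :=
  (∀ f ∈ F, (Finset.univ.filter fun x => f x = 1).card = ⌈α * (n : ℝ)⌉₊) ∧
  ∀ S₀ S₁ : Finset (Fin n), Disjoint S₀ S₁ → S₀.card = k₀ → S₁.card = k₁ →
    ∃ f ∈ F, (∀ x ∈ S₀, f x = 0) ∧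
      (S₁.filter fun x => f x = 1).card = ⌈β * (k₁ : ℝ)⌉₊

lemma greedy_cover {A B : Type*} [DecidableEq A] [DecidableEq B] (Ω : Finset A) (P : Finset B)
    (R : A → B → Prop) [∀ a b, Decidable (R a b)] (p : ℝ) (hp1 : p ≤ 1) (hΩ : Ω.Nonempty)
    (h : ∀ x ∈ P, p * Ω.card ≤ ((Ω.filter fun f => R f x).card : ℝ)) (t : ℕ) :
    ∃ F ⊆ Ω, F.card ≤ t ∧
      ((P.filter fun x => ∀ f ∈ F, ¬ R f x).card : ℝ) ≤ P.card * (1 - p) ^ t := by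
  induction t with
  | zero => exact ⟨∅, by simp, by simp, by simp⟩
  | succ t ih =>
    obtain ⟨F, hF, hc, hU⟩ := ih
    set U := P.filter fun x => ∀ f ∈ F, ¬ R f x with hUdef
    have hsum : ∑ f ∈ Ω, (p * (U.card : ℝ)) ≤ ∑ f ∈ Ω, ((U.filter fun x => R f x).card : ℝ) := by
      have e : ∑ f ∈ Ω, ((U.filter fun x => R f x).card : ℝ)
          = ∑ x ∈ U, ((Ω.filter fun f => R f x).card : ℝ) := by
        simp only [Finset.card_filter, Nat.cast_sum]
        exact Finset.sum_comm
      rw [e, Finset.sum_const, nsmul_eq_mul]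
      calc (Ω.card : ℝ) * (p * U.card) = ∑ x ∈ U, p * (Ω.card : ℝ) := by
            rw [Finset.sum_const, nsmul_eq_mul]; ring
        _ ≤ _ := Finset.sum_le_sum fun x hx => h x (Finset.mem_filter.1 hx).1
    obtain ⟨f, hf, hfle⟩ := Finset.exists_le_of_sum_le hΩ hsum
    refine ⟨insert f F, Finset.insert_subset hf hF, (Finset.card_insert_le _ _).trans (by omega), ?_⟩
    have e1 : (P.filter fun x => ∀ g ∈ insert f F, ¬ R g x) = U.filter fun x => ¬ R f x := by
      ext x; simp [hUdef]; tauto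
    have e2 := Finset.card_filter_add_card_filter_not (s := U) (fun x => R f x)
    have e3 : ((U.filter fun x => R f x).card : ℝ) + ((U.filter fun x => ¬ R f x).card : ℝ)
        = U.card := by exact_mod_cast e2
    rw [e1, pow_succ]
    have : (U.card : ℝ) * (1 - p) ≤ (P.card * (1 - p) ^ t) * (1 - p) :=
      mul_le_mul_of_nonneg_right hU (by linarith)
    linarith

lemma cover {A B : Type*} [DecidableEq A] [DecidableEq B] (Ω : Finset A) (P : Finset B)
    (R : A → B → Prop) [∀ a b, Decidable (R a b)] (p : ℝ) (hp : 0 < p) (hΩ : Ω.Nonempty)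
    (h : ∀ x ∈ P, p * Ω.card ≤ ((Ω.filter fun f => R f x).card : ℝ)) :
    ∃ F ⊆ Ω, (∀ x ∈ P, ∃ f ∈ F, R f x) ∧ p * F.card ≤ Real.log P.card + 1 := by
  rcases P.eq_empty_or_nonempty with rfl | ⟨x₀, hx₀⟩
  · exact ⟨∅, by simp, by simp, by simp⟩
  have hΩc : (0 : ℝ) < Ω.card := by exact_mod_cast hΩ.card_pos
  have hp1 : p ≤ 1 := by
    have h1 := h x₀ hx₀
    have h2 : ((Ω.filter fun f => R f x₀).card : ℝ) ≤ Ω.card := by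
      exact_mod_cast Finset.card_filter_le _ _
    by_contra hcon
    push Not at hcon
    nlinarith
  have hPc : (1 : ℝ) ≤ P.card := by exact_mod_cast Finset.card_pos.2 ⟨x₀, hx₀⟩
  have hL : 0 ≤ Real.log P.card := Real.log_nonneg hPc
  obtain ⟨F, hF, hc, hU⟩ := greedy_cover Ω P R p hp1 hΩ h (⌊Real.log P.card / p⌋₊ + 1)
  set t := ⌊Real.log P.card / p⌋₊ + 1 with ht
  have ht1 : Real.log P.card < p * t := by
    have := Nat.lt_floor_add_one (Real.log P.card / p)
    rw [div_lt_iff₀ hp] at this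
    rw [ht]; push_cast; linarith
  have ht2 : p * t ≤ Real.log P.card + 1 := by
    have := Nat.floor_le (div_nonneg hL hp.le)
    rw [le_div_iff₀ hp] at this
    rw [ht]; push_cast; linarith
  refine ⟨F, hF, ?_, ?_⟩
  · have hlt : (P.card : ℝ) * (1 - p) ^ t < 1 := by
      have h1 : (1 - p) ^ t ≤ Real.exp (-(p * t)) := by
        calc (1 - p) ^ t ≤ (Real.exp (-p)) ^ t := by
              have h0 : 0 ≤ 1 - p := by linarith
              have h1 : 1 - p ≤ Real.exp (-p) := by
                have := Real.add_one_le_exp (-p); linarith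
              exact pow_le_pow_left₀ h0 h1 t
          _ = _ := by rw [← Real.exp_nat_mul]; ring_nf
      calc (P.card : ℝ) * (1 - p) ^ t ≤ P.card * Real.exp (-(p * t)) := by gcongr
        _ = Real.exp (Real.log P.card - p * t) := by
            rw [sub_eq_add_neg, Real.exp_add, Real.exp_log (by linarith)]
        _ < 1 := by rw [Real.exp_lt_one_iff]; linarith
    have h0 : (P.filter fun x => ∀ f ∈ F, ¬ R f x).card = 0 := by
      have : ((P.filter fun x => ∀ f ∈ F, ¬ R f x).card : ℝ) < 1 := lt_of_le_of_lt hU hlt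
      have : (P.filter fun x => ∀ f ∈ F, ¬ R f x).card < 1 := by exact_mod_cast this
      omega
    rw [Finset.card_eq_zero, Finset.filter_eq_empty_iff] at h0
    intro x hx
    have := h0 hx
    push Not at this
    exact this
  · have : (F.card : ℝ) ≤ t := by exact_mod_cast hc
    nlinarith

lemma chooseA (N m b : ℕ) :
    (N + b).choose (m + b) * m ^ b ≤ N.choose m * (N + b) ^ b := by
  induction b with
  | zero => simp
  | succ b ih =>
    have e := Nat.add_one_mul_choose_eq (N + b) (m + b)
    calc (N + (b + 1)).choose (m + (b + 1)) * m ^ (b + 1)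
        = ((N + b + 1).choose (m + b + 1) * m) * m ^ b := by ring_nf
      _ ≤ ((N + b + 1).choose (m + b + 1) * (m + b + 1)) * m ^ b :=
          Nat.mul_le_mul_right _ (Nat.mul_le_mul_left _ (by omega))
      _ = (N + b + 1) * ((N + b).choose (m + b) * m ^ b) := by rw [← e]; ring
      _ ≤ (N + b + 1) * (N.choose m * (N + b) ^ b) := by gcongr
      _ ≤ (N + b + 1) * (N.choose m * (N + b + 1) ^ b) :=
          Nat.mul_le_mul_left _ (Nat.mul_le_mul_left _ (Nat.pow_le_pow_left (by omega) _))
      _ = _ := by ring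

lemma chooseAB (M R b c n : ℕ) (hn : M + R + c + b = n) :
    n.choose (M + b) * (M ^ b * R ^ c) ≤ (M + R).choose M * n ^ (b + c) := by
  have h1 := chooseA (M + R + c) M b
  have h2 := chooseA (M + R) R c
  have e1 : (M + R + c).choose (R + c) = (M + R + c).choose M := by
    exact Nat.choose_symm_of_eq_add (by omega)
  have e2 : (M + R).choose R = (M + R).choose M := by
    exact Nat.choose_symm_of_eq_add (by omega)
  rw [e1, e2] at h2
  rw [hn] at h1
  calc n.choose (M + b) * (M ^ b * R ^ c) = (n.choose (M + b) * M ^ b) * R ^ c := by ring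
    _ ≤ ((M + R + c).choose M * n ^ b) * R ^ c := by gcongr
    _ = ((M + R + c).choose M * R ^ c) * n ^ b := by ring
    _ ≤ ((M + R).choose M * (M + R + c) ^ c) * n ^ b := by gcongr
    _ ≤ ((M + R).choose M * n ^ c) * n ^ b := by gcongr; omega
    _ = _ := by ring

lemma good_count (n k₀ k₁ m b : ℕ) (hb : b ≤ m) (S₀ S₁ : Finset (Fin n)) (hd : Disjoint S₀ S₁)
    (h0 : S₀.card = k₀) (h1 : S₁.card = k₁) :
    k₁.choose b * (n - (k₀ + k₁)).choose (m - b) ≤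
      ((powersetCard m (univ : Finset (Fin n))).filter
        fun T => Disjoint S₀ T ∧ (S₁ ∩ T).card = b).card := by
  have hc : (univ \ (S₀ ∪ S₁)).card = n - (k₀ + k₁) := by
    rw [card_sdiff_of_subset (subset_univ _), card_union_of_disjoint hd, h0, h1]; simp
  have hl : k₁.choose b * (n - (k₀ + k₁)).choose (m - b) =
      (powersetCard b S₁ ×ˢ powersetCard (m - b) (univ \ (S₀ ∪ S₁))).card := by
    rw [card_product, card_powersetCard, card_powersetCard, hc, h1]
  rw [hl]
  have key : ∀ q ∈ powersetCard b S₁ ×ˢ powersetCard (m - b) (univ \ (S₀ ∪ S₁)),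
      S₁ ∩ (q.1 ∪ q.2) = q.1 ∧ (q.1 ∪ q.2) \ S₁ = q.2 ∧ Disjoint S₀ (q.1 ∪ q.2)
        ∧ Disjoint q.1 q.2 := by
    rintro ⟨X, Y⟩ hq
    simp only [mem_product, mem_powersetCard] at hq
    obtain ⟨⟨hX, -⟩, hY, -⟩ := hq
    have hX' : ∀ x, x ∈ X → x ∈ S₁ := fun x hx => hX hx
    have hY' : ∀ x, x ∈ Y → x ∉ S₀ ∧ x ∉ S₁ := fun x hx => by
      have := hY hx
      simpa using this
    rw [Finset.disjoint_left] at hd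
    refine ⟨?_, ?_, ?_, ?_⟩
    · ext x; simp only [mem_inter, mem_union]; have := hX' x; have := hY' x; tauto
    · ext x; simp only [mem_sdiff, mem_union]; have := hX' x; have := hY' x; tauto
    · rw [Finset.disjoint_left]; intro x hx; have := hd hx
      simp only [mem_union]; have := hX' x; have := hY' x; tauto
    · rw [Finset.disjoint_left]; intro x hx; have := hX' x; have := hY' x; tauto
  apply Finset.card_le_card_of_injOn (fun q => q.1 ∪ q.2)
  · intro q hq
    obtain ⟨a1, a2, a3, a4⟩ := key q hq
    have hq' := hq
    simp only [coe_product, Set.mem_prod, mem_coe, mem_powersetCard] at hq'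
    simp only [coe_filter, mem_powersetCard, Set.mem_setOf_eq]
    refine ⟨⟨subset_univ _, ?_⟩, a3, ?_⟩
    · rw [card_union_of_disjoint a4, hq'.1.2, hq'.2.2]; omega
    · rw [a1]; exact hq'.1.2
  · intro q hq q' hq' he
    obtain ⟨a1, a2, -, -⟩ := key q hq
    obtain ⟨b1, b2, -, -⟩ := key q' hq'
    simp only at he
    ext1
    · rw [← a1, ← b1, he]
    · rw [← a2, ← b2, he]

lemma real_bound (w n M R : ℝ) (b c : ℕ) (hw : 4 ≤ w) (hn : w ^ 8 ≤ n) (hb : (b : ℝ) ≤ w ^ 2)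
    (hc : (c : ℝ) ≤ w ^ 2) (hM : n / w - w ^ 2 ≤ M) (hR : n - n / w - 1 - w ^ 2 ≤ R) :
    1 / 40 * ((w ^ b)⁻¹ * Real.exp (-(c / w))) * n ^ (b + c) ≤ M ^ b * R ^ c := by
  have hw0 : 0 < w := by linarith
  have h6 : (4:ℝ) ^ 3 ≤ w ^ 3 := by gcongr
  have h62 : (4:ℝ) ^ 4 ≤ w ^ 4 := by gcongr
  have hw2 : (4:ℝ) ^ 2 ≤ w ^ 2 := by gcongr
  have hn0 : 0 < n := lt_of_lt_of_le (by positivity) hn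
  -- M part
  have hMb : 1 / 2 * ((w ^ b)⁻¹ * n ^ b) ≤ M ^ b := by
    have hy : w ^ 2 * (w ^ 3 / n) ≤ 1 / 2 := by
      rw [← mul_div_assoc, div_le_iff₀ hn0]
      have : w ^ 8 = w ^ 2 * w ^ 3 * w ^ 3 := by ring
      nlinarith [mul_le_mul_of_nonneg_left h6 (by positivity : 0 ≤ w ^ 2 * w ^ 3), (by positivity : 0 ≤ w ^ 2 * w ^ 3)]
    have hy0 : 0 ≤ w ^ 3 / n := by positivity
    have hy1 : w ^ 3 / n ≤ 1 := by nlinarith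
    have hB := one_add_mul_le_pow (a := -(w ^ 3 / n)) (by linarith) b
    have e : n / w - w ^ 2 = n / w * (1 + -(w ^ 3 / n)) := by field_simp; ring
    have : (n / w * (1 + -(w ^ 3 / n))) ^ b ≤ M ^ b := by
      rw [← e]
      have : 0 ≤ n / w - w ^ 2 := by rw [e]; apply mul_nonneg (by positivity); linarith
      gcongr
    refine le_trans ?_ this
    rw [mul_pow, div_pow]
    have h2 : 1 / 2 ≤ (1 + -(w ^ 3 / n)) ^ b := by nlinarith
    calc 1 / 2 * ((w ^ b)⁻¹ * n ^ b) = n ^ b / w ^ b * (1 / 2) := by field_simp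
      _ ≤ _ := by gcongr
  have hRc : 1 / 20 * (Real.exp (-(c / w)) * n ^ c) ≤ R ^ c := by
    have hy : w ^ 2 * (4 * w ^ 2 / n) ≤ 1 / 2 := by
      rw [← mul_div_assoc, div_le_iff₀ hn0]
      have : w ^ 8 = w ^ 4 * w ^ 4 := by ring
      have : w ^ 4 = w ^ 2 * w ^ 2 := by ring
      nlinarith
    have hy0 : 0 ≤ 4 * w ^ 2 / n := by positivity
    have hy1 : 4 * w ^ 2 / n ≤ 1 := by nlinarith
    have hB := one_add_mul_le_pow (a := -(4 * w ^ 2 / n)) (by linarith) c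
    have h2 : 1 / 2 ≤ (1 + -(4 * w ^ 2 / n)) ^ c := by nlinarith
    have hx : 1 / w ≤ 1 / 4 := by gcongr
    have hx0 : 0 < 1 / w := by positivity
    have e : n * (1 - 1 / w) * (1 + -(4 * w ^ 2 / n)) ≤ n - n / w - 1 - w ^ 2 := by
      have : n * (1 - 1 / w) * (1 + -(4 * w ^ 2 / n)) = n - n / w - 4 * w ^ 2 * (1 - 1 / w) := by
        field_simp
        ring
      rw [this]; nlinarith
    have h3 : (n * (1 - 1 / w) * (1 + -(4 * w ^ 2 / n))) ^ c ≤ R ^ c := by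
      have : 0 ≤ n * (1 - 1 / w) * (1 + -(4 * w ^ 2 / n)) := by
        apply mul_nonneg (mul_nonneg hn0.le (by linarith)); linarith
      gcongr
      linarith
    refine le_trans ?_ h3
    rw [mul_pow, mul_pow]
    have h4 : Real.exp (-(1 / w)) * Real.exp (-(2 * (1 / w) ^ 2)) ≤ 1 - 1 / w := by
      set x := 1 / w
      have a1 : 1 + x ≤ Real.exp x := by linarith [Real.add_one_le_exp x]
      have a2 : 1 + 2 * x ^ 2 ≤ Real.exp (2 * x ^ 2) := by linarith [Real.add_one_le_exp (2 * x ^ 2)]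
      rw [Real.exp_neg, Real.exp_neg, ← mul_inv]
      rw [inv_le_iff_one_le_mul₀ (by positivity)]
      have a3 : (1 + x) * (1 + 2 * x ^ 2) ≤ Real.exp x * Real.exp (2 * x ^ 2) := by gcongr
      have a4 : 1 ≤ (1 - x) * ((1 + x) * (1 + 2 * x ^ 2)) := by
        have : (1 - x) * ((1 + x) * (1 + 2 * x ^ 2)) = 1 + x ^ 2 * (1 - 2 * x ^ 2) := by ring
        rw [this]
        have : 0 ≤ 1 - 2 * x ^ 2 := by nlinarith
        nlinarith [mul_nonneg (sq_nonneg x) this]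
      nlinarith
    have h5 : Real.exp (-(c / w)) * (1 / 10) ≤ (1 - 1 / w) ^ c := by
      calc Real.exp (-(c / w)) * (1 / 10) ≤ Real.exp (-(c / w)) * Real.exp (-(c * (2 * (1 / w) ^ 2))) := by
            gcongr
            have a1 : (c : ℝ) * (2 * (1 / w) ^ 2) ≤ 2 := by
              have : (c : ℝ) * (2 * (1 / w) ^ 2) = 2 * c / w ^ 2 := by field_simp
              rw [this, div_le_iff₀ (by positivity)]; linarith
            have a2 : Real.exp (-2) ≤ Real.exp (-(c * (2 * (1 / w) ^ 2))) := by
              apply Real.exp_le_exp.2; linarith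
            refine le_trans ?_ a2
            rw [Real.exp_neg, one_div]
            apply inv_anti₀ (Real.exp_pos _)
            have := Real.exp_one_lt_d9
            have e2 : Real.exp 2 = Real.exp 1 * Real.exp 1 := by rw [← Real.exp_add]; norm_num
            rw [e2]; nlinarith [Real.exp_pos 1]
        _ = (Real.exp (-(1 / w)) * Real.exp (-(2 * (1 / w) ^ 2))) ^ c := by
            rw [mul_pow, ← Real.exp_nat_mul, ← Real.exp_nat_mul]; ring_nf
        _ ≤ _ := by gcongr
    calc 1 / 20 * (Real.exp (-(c / w)) * n ^ c)
        = n ^ c * (Real.exp (-(c / w)) * (1 / 10)) * (1 / 2) := by ring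
      _ ≤ n ^ c * (1 - 1 / w) ^ c * (1 + -(4 * w ^ 2 / n)) ^ c := by
        have : 0 ≤ 1 - 1 / w := by linarith
        gcongr
  calc 1 / 40 * ((w ^ b)⁻¹ * Real.exp (-(c / w))) * n ^ (b + c)
      = (1 / 2 * ((w ^ b)⁻¹ * n ^ b)) * (1 / 20 * (Real.exp (-(c / w)) * n ^ c)) := by
        rw [pow_add]; ring
    _ ≤ _ := mul_le_mul hMb hRc (by positivity) (le_trans (by positivity) hMb)

set_option maxHeartbeats 1000000 in
theorem mapping_family_general_universe :
    ∃ C : ℝ, 0 < C ∧ ∃ K : ℕ, ∀ k : ℕ, K ≤ k → ∀ k₀ k₁ : ℕ, k₀ + k₁ ≤ k →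
      ∀ β : ℝ, 0 ≤ β → β ≤ 1 → ∀ n : ℕ, k ^ 4 ≤ n →
      ∃ F : Finset (Fin n → Fin 2),
        IsMappingFamily n k₀ k₁ (1 / Real.sqrt k) β F ∧
          (F.card : ℝ) ≤
            C * ((k₁.choose ⌈β * (k₁ : ℝ)⌉₊ : ℝ))⁻¹ *
              Real.sqrt k ^ ⌈β * (k₁ : ℝ)⌉₊ *
              Real.exp (((k₀ : ℝ) + (k₁ : ℝ)) / Real.sqrt k) *
              (k : ℝ) ^ 8 * Real.logb 2 k * Real.logb 2 n := by
  refine ⟨80, by norm_num, 16, ?_⟩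
  intro k hk k₀ k₁ hs β hβ0 hβ1 n hn
  have hbk : ⌈β * (k₁ : ℝ)⌉₊ ≤ k₁ := by
    rw [Nat.ceil_le]
    have : (0 : ℝ) ≤ k₁ := by positivity
    nlinarith
  set b := ⌈β * (k₁ : ℝ)⌉₊ with hb
  set w := Real.sqrt k with hwdef
  set m := ⌈1 / w * (n : ℝ)⌉₊ with hm
  have hkR : (16 : ℝ) ≤ k := by exact_mod_cast hk
  have hw2 : w ^ 2 = k := Real.sq_sqrt (by positivity)
  have hw : 4 ≤ w := by
    rw [hwdef]; apply Real.le_sqrt_of_sq_le; linarith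
  have hw0 : 0 < w := by linarith
  have hnR : w ^ 8 ≤ n := by
    have : w ^ 8 = (k : ℝ) ^ 4 := by rw [← hw2]; ring
    rw [this]; exact_mod_cast hn
  have hn0 : (0 : ℝ) < n := lt_of_lt_of_le (by positivity) hnR
  have hm1 : (n : ℝ) / w ≤ m := by
    have := Nat.le_ceil (1 / w * (n : ℝ)); rw [← hm] at this
    calc (n : ℝ) / w = 1 / w * n := by ring
      _ ≤ _ := this
  have hm2 : (m : ℝ) ≤ n / w + 1 := by
    have := Nat.ceil_lt_add_one (a := 1 / w * (n : ℝ)) (by positivity); rw [← hm] at this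
    have e : (n : ℝ) / w = 1 / w * n := by ring
    linarith
  have hw4 : (4:ℝ) ^ 4 ≤ w ^ 4 := by gcongr
  have hkm : k ≤ m := by
    have : (k : ℝ) ≤ m := by
      refine le_trans ?_ hm1
      rw [le_div_iff₀ hw0, ← hw2]
      have : w ^ 8 = w ^ 3 * (w * w ^ 4) := by ring
      have h3 : 0 < w ^ 3 := by positivity
      nlinarith
    exact_mod_cast this
  have hmk : m + k ≤ n := by
    have : (m : ℝ) + k ≤ n := by
      have h1 : (n : ℝ) / w ≤ n / 4 := by gcongr
      have h2 : (k : ℝ) ≤ n / 4 := by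
        rw [← hw2]
        have : w ^ 8 = w ^ 2 * (w ^ 2 * w ^ 4) := by ring
        have h3 : (4:ℝ)^2 ≤ w ^ 2 := by gcongr
        have h4 : 0 < w ^ 2 := by positivity
        have h5 : w ^ 2 * 4 ≤ w ^ 2 * (w ^ 2 * w ^ 4) := by
          gcongr; nlinarith
        linarith
      linarith
    exact_mod_cast this
  -- decomposition
  obtain ⟨c, hc⟩ : ∃ c, k₀ + k₁ = b + c := ⟨k₀ + k₁ - b, by omega⟩
  obtain ⟨M, hM⟩ : ∃ M, m = M + b := ⟨m - b, by omega⟩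
  obtain ⟨R, hR⟩ : ∃ R, n = M + R + c + b := ⟨n - (M + c + b), by omega⟩
  have hAB := chooseAB M R b c n hR.symm
  have hbR : (b : ℝ) ≤ k := by exact_mod_cast (by omega : b ≤ k)
  have hcR : (c : ℝ) ≤ k := by exact_mod_cast (by omega : c ≤ k)
  have hMR : (m : ℝ) = M + b := by exact_mod_cast hM
  have hRR : (n : ℝ) = M + R + c + b := by exact_mod_cast hR
  have hrb := real_bound w n M R b c hw hnR (by rw [hw2]; exact hbR) (by rw [hw2]; exact hcR)
    (by rw [hw2]; linarith) (by rw [hw2]; linarith)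
  set q : ℝ := 1 / 40 * ((w ^ b)⁻¹ * Real.exp (-(c / w))) with hq
  have hq0 : 0 < q := by positivity
  have hratio : q * n.choose m ≤ ((M + R).choose M : ℝ) := by
    have hAB' : (n.choose m : ℝ) * ((M : ℝ) ^ b * (R : ℝ) ^ c) ≤
        ((M + R).choose M : ℝ) * (n : ℝ) ^ (b + c) := by rw [hM]; exact_mod_cast hAB
    have hpos : (0 : ℝ) < (n : ℝ) ^ (b + c) := by positivity
    refine le_of_mul_le_mul_right ?_ hpos
    calc q * n.choose m * (n : ℝ) ^ (b + c) = n.choose m * (q * (n : ℝ) ^ (b + c)) := by ring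
      _ ≤ n.choose m * ((M : ℝ) ^ b * (R : ℝ) ^ c) := by gcongr
      _ ≤ _ := hAB'
  have hch : (0 : ℝ) < k₁.choose b := by exact_mod_cast Nat.choose_pos hbk
  classical
  obtain ⟨F, hF, hcov, hcard⟩ := cover (powersetCard m (univ : Finset (Fin n)))
    (((powersetCard k₀ (univ : Finset (Fin n))) ×ˢ
      (powersetCard k₁ (univ : Finset (Fin n)))).filter fun x => Disjoint x.1 x.2)
    (fun T x => Disjoint x.1 T ∧ (x.2 ∩ T).card = b) (k₁.choose b * q) (by positivity)
    (by rw [powersetCard_nonempty]; simp; omega)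
    (by
      rintro ⟨S₀, S₁⟩ hx
      simp only [mem_filter, mem_product, mem_powersetCard] at hx
      have hg := good_count n k₀ k₁ m b (by omega) S₀ S₁ hx.2 hx.1.1.2 hx.1.2.2
      have e1 : n - (k₀ + k₁) = M + R := by omega
      have e2 : m - b = M := by omega
      rw [e1, e2] at hg
      simp only [card_powersetCard, card_univ, Fintype.card_fin]
      calc (k₁.choose b : ℝ) * q * n.choose m = k₁.choose b * (q * n.choose m) := by ring
        _ ≤ k₁.choose b * ((M + R).choose M : ℝ) := by gcongr
        _ ≤ _ := by exact_mod_cast hg)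
  set P := (((powersetCard k₀ (univ : Finset (Fin n))) ×ˢ
      (powersetCard k₁ (univ : Finset (Fin n)))).filter fun x => Disjoint x.1 x.2) with hP
  let ind : Finset (Fin n) → (Fin n → Fin 2) := fun T x => if x ∈ T then 1 else 0
  have hind1 : ∀ T x, ind T x = 1 ↔ x ∈ T := by intro T x; simp [ind]
  have hind0 : ∀ T x, ind T x = 0 ↔ x ∉ T := by intro T x; simp [ind]
  refine ⟨F.image ind, ⟨?_, ?_⟩, ?_⟩
  · intro f hf
    obtain ⟨T, hT, rfl⟩ := mem_image.1 hf
    have := (mem_powersetCard.1 (hF hT)).2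
    simp only [hind1]
    rw [Finset.filter_mem_eq_inter, Finset.univ_inter]
    exact this
  · intro S₀ S₁ hd h0 h1
    obtain ⟨T, hT, hT1, hT2⟩ := hcov (S₀, S₁) (by
      simp only [hP, mem_filter, mem_product, mem_powersetCard]
      exact ⟨⟨⟨subset_univ _, h0⟩, subset_univ _, h1⟩, hd⟩)
    refine ⟨ind T, mem_image_of_mem _ hT, ?_, ?_⟩
    · intro x hx
      rw [hind0]
      exact Finset.disjoint_left.1 hT1 hx
    · simp only [hind1]
      rw [Finset.filter_mem_eq_inter]
      exact hT2
  · have hlogn1 : 1 ≤ Real.log n := by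
      rw [Real.le_log_iff_exp_le hn0]
      have := Real.exp_one_lt_d9
      have : (4:ℝ)^8 ≤ w ^ 8 := by gcongr
      linarith
    have hPcard : (P.card : ℝ) ≤ (n : ℝ) ^ k := by
      have h1 : P.card ≤ n ^ k := by
        calc P.card ≤ _ := card_filter_le _ _
          _ = n.choose k₀ * n.choose k₁ := by simp
          _ ≤ n ^ k₀ * n ^ k₁ := Nat.mul_le_mul (Nat.choose_le_pow _ _) (Nat.choose_le_pow _ _)
          _ = n ^ (k₀ + k₁) := by rw [pow_add]
          _ ≤ n ^ k := Nat.pow_le_pow_right (by omega) hs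
      exact_mod_cast h1
    have hlogP : Real.log P.card ≤ k * Real.log n := by
      rcases Nat.eq_zero_or_pos P.card with h | h
      · rw [h]; simp; positivity
      · rw [← Real.log_pow]
        exact Real.log_le_log (by exact_mod_cast h) hPcard
    have hl2 : ∀ x : ℝ, 0 ≤ Real.log x → Real.log x ≤ Real.logb 2 x := by
      intro x hx
      rw [Real.logb, le_div_iff₀ (Real.log_pos (by norm_num))]
      have := Real.log_two_lt_d9
      nlinarith
    have hln : Real.log n ≤ Real.logb 2 n := hl2 _ (by linarith)
    have hlk : 1 ≤ Real.logb 2 k := by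
      rw [Real.le_logb_iff_rpow_le (by norm_num) (by linarith)]
      simp; linarith
    have hk8 : (k : ℝ) ≤ (k : ℝ) ^ 8 := le_self_pow₀ (by linarith) (by norm_num)
    have h1 : (k₁.choose b * q) * F.card ≤ 2 * ((k : ℝ) ^ 8 * Real.logb 2 k * Real.logb 2 n) := by
      calc (k₁.choose b * q) * F.card ≤ Real.log P.card + 1 := hcard
        _ ≤ 2 * (k * 1 * Real.log n) := by nlinarith
        _ ≤ _ := by gcongr
    have h2 : (F.card : ℝ) ≤ (2 * ((k : ℝ) ^ 8 * Real.logb 2 k * Real.logb 2 n)) / (k₁.choose b * q) := by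
      rw [le_div_iff₀ (by positivity)]; linarith
    have h3 : ((F.image ind).card : ℝ) ≤ F.card := by exact_mod_cast card_image_le
    refine h3.trans (h2.trans ?_)
    have h4 : q⁻¹ = 40 * (w ^ b * Real.exp (c / w)) := by
      rw [hq, Real.exp_neg]
      simp only [mul_inv, inv_inv, one_div]
    have h5 : Real.exp (c / w) ≤ Real.exp (((k₀ : ℝ) + k₁) / w) := by
      apply Real.exp_le_exp.2
      gcongr
      exact_mod_cast (by omega : c ≤ k₀ + k₁)
    have hlb : 0 ≤ Real.logb 2 n := by linarith
    rw [div_eq_mul_inv, mul_inv, h4]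
    calc 2 * ((k : ℝ) ^ 8 * Real.logb 2 k * Real.logb 2 n) *
          ((k₁.choose b : ℝ)⁻¹ * (40 * (w ^ b * Real.exp (c / w))))
        = 80 * (k₁.choose b : ℝ)⁻¹ * w ^ b * Real.exp (c / w) * (k : ℝ) ^ 8 *
          Real.logb 2 k * Real.logb 2 n := by ring
      _ ≤ _ := by
        have h6 : (0 : ℝ) ≤ 80 * (k₁.choose b : ℝ)⁻¹ * w ^ b := by positivity
        have h7 : (0 : ℝ) ≤ (k : ℝ) ^ 8 := by positivity
        have h8 : 0 ≤ Real.logb 2 k := by linarith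
        exact mul_le_mul_of_nonneg_right (mul_le_mul_of_nonneg_right
          (mul_le_mul_of_nonneg_right (mul_le_mul_of_nonneg_left h5 h6) h7) h8) hlb
end

section
/- For every real α with 0 < α < 1 there exist a constant C > 0 and an integer K such that for all nonnegative integers k₀, k₁ with k := k₀ + k₁ ≥ K and every integer n ≥ k⁴, there exists an (n, k₀, k₁, α, 1)-mapping family of size at most (1/(1−α))^{k₀} · (1/α)^{k₁} · (k·ln n)^{C·√k}. -/
open Finset

lemma mf_desc_lower (M j : ℕ) (y : ℝ) (hy : 0 < y) (hM : y - 1 ≤ M)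
    (hj : 2 * (j : ℝ) * (j + 1) ≤ y) :
    j ≤ M ∧ y ^ j / 2 ≤ (M.descFactorial j : ℝ) := by
  have hjM : j ≤ M := by
    rcases Nat.eq_zero_or_pos j with h | h
    · simp [h]
    · have h1 : (1 : ℝ) ≤ j := by exact_mod_cast h
      have : (j : ℝ) ≤ M := by nlinarith
      exact_mod_cast this
  refine ⟨hjM, ?_⟩
  have h1 : (((M + 1 - j) ^ j : ℕ) : ℝ) ≤ (M.descFactorial j : ℝ) := by
    exact_mod_cast Nat.pow_sub_le_descFactorial M j
  refine le_trans ?_ h1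
  rw [Nat.cast_pow, Nat.cast_sub (by omega)]
  push_cast
  have hj0 : (0 : ℝ) ≤ j := Nat.cast_nonneg j
  have hjy : (j : ℝ) ≤ y := by nlinarith
  have h2 : (y - j) ^ j ≤ ((M : ℝ) + 1 - j) ^ j := by
    apply pow_le_pow_left₀ <;> linarith
  refine le_trans ?_ h2
  have h3 : y - j = y * (1 + -(j / y)) := by field_simp; ring
  rw [h3, mul_pow]
  have hq : (j : ℝ) / y ≤ 1 := by rw [div_le_one hy]; exact hjy
  have h4 := one_add_mul_le_pow (a := -((j : ℝ) / y)) (by linarith) j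
  have h5 : (j : ℝ) * (j / y) ≤ 1 / 2 := by
    rw [← mul_div_assoc, div_le_iff₀ hy]; nlinarith
  have h6 : 0 < y ^ j := by positivity
  nlinarith

lemma mf_greedy {A P : Type*} [DecidableEq A] [DecidableEq P] (Ω : Finset A) (R : A → P → Prop)
    [∀ a q, Decidable (R a q)] (p : ℝ) (Q : Finset P)
    (hΩ : Ω.Nonempty)
    (h : ∀ q ∈ Q, p * Ω.card ≤ ((Ω.filter fun a => R a q).card : ℝ)) (t : ℕ) :
    ∃ F ⊆ Ω, F.card ≤ t ∧
      ((Q.filter fun q => ∀ a ∈ F, ¬ R a q).card : ℝ) ≤ Q.card * Real.exp (-p) ^ t := by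
  induction t with
  | zero => exact ⟨∅, by simp, by simp, by simp⟩
  | succ t ih =>
    obtain ⟨F, hF, hc, hu⟩ := ih
    set U := Q.filter fun q => ∀ a ∈ F, ¬ R a q with hU
    have hex : ∃ a ∈ Ω, p * U.card ≤ ((U.filter fun q => R a q).card : ℝ) := by
      by_contra hcon
      push Not at hcon
      have h1 : ∑ a ∈ Ω, ((U.filter fun q => R a q).card : ℝ) < ∑ a ∈ Ω, p * U.card :=
        Finset.sum_lt_sum_of_nonempty hΩ hcon
      have h2 : ∑ q ∈ U, p * Ω.card ≤ ∑ q ∈ U, ((Ω.filter fun a => R a q).card : ℝ) :=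
        Finset.sum_le_sum fun q hq => h q (Finset.mem_of_mem_filter q hq)
      have h3 : ∑ a ∈ Ω, ((U.filter fun q => R a q).card : ℝ)
          = ∑ q ∈ U, ((Ω.filter fun a => R a q).card : ℝ) := by
        exact_mod_cast Finset.sum_card_bipartiteAbove_eq_sum_card_bipartiteBelow R
      simp only [Finset.sum_const, nsmul_eq_mul] at h1 h2
      nlinarith
    obtain ⟨a, ha, hpa⟩ := hex
    refine ⟨insert a F, Finset.insert_subset ha hF,
      (Finset.card_insert_le _ _).trans (by omega), ?_⟩
    have h4 : (Q.filter fun q => ∀ b ∈ insert a F, ¬ R b q) = U.filter fun q => ¬ R a q := by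
      ext q; simp [hU]; tauto
    rw [h4]
    have h5 : ((U.filter fun q => R a q).card : ℝ) + ((U.filter fun q => ¬ R a q).card : ℝ)
        = U.card := by exact_mod_cast Finset.card_filter_add_card_filter_not (s := U) (fun q => R a q)
    have h6 := Real.add_one_le_exp (-p)
    have h7 : (0 : ℝ) ≤ U.card := Nat.cast_nonneg _
    have h8 := Real.exp_pos (-p)
    rw [pow_succ, ← mul_assoc]
    nlinarith [mul_le_mul_of_nonneg_right hu h8.le, mul_le_mul_of_nonneg_left h6 h7]

lemma mf_count (n m k₀ k₁ : ℕ) (h1 : k₁ ≤ m) (S₀ S₁ : Finset (Fin n)) (hd : Disjoint S₀ S₁)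
    (hk0 : S₀.card = k₀) (hk1 : S₁.card = k₁) :
    (n - (k₀ + k₁)).choose (m - k₁) ≤
      ((powersetCard m (univ : Finset (Fin n))).filter
        fun A => Disjoint S₀ A ∧ S₁ ⊆ A).card := by
  have hc : (powersetCard (m - k₁) (univ \ (S₀ ∪ S₁))).card
      = (n - (k₀ + k₁)).choose (m - k₁) := by
    rw [card_powersetCard, card_sdiff_of_subset (subset_univ _), card_union_of_disjoint hd]
    simp [hk0, hk1]
  rw [← hc]
  apply Finset.card_le_card_of_injOn (fun T => T ∪ S₁)
  · intro T hT
    simp only [mem_coe, mem_powersetCard] at hT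
    obtain ⟨hT, hTc⟩ := hT
    rw [subset_sdiff] at hT
    have hT' := disjoint_union_right.1 hT.2
    simp only [mem_coe, mem_filter, mem_powersetCard]
    refine ⟨⟨subset_univ _, ?_⟩, ?_, subset_union_right⟩
    · rw [card_union_of_disjoint hT'.2]; omega
    · exact disjoint_union_right.2 ⟨hT'.1.symm, hd⟩
  · intro T hT T' hT' he
    simp only [mem_coe, mem_powersetCard, subset_sdiff, disjoint_union_right] at hT hT'
    have e1 : (T ∪ S₁) \ S₁ = T := union_sdiff_cancel_right hT.1.2.2
    have e2 : (T' ∪ S₁) \ S₁ = T' := union_sdiff_cancel_right hT'.1.2.2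
    simp only at he
    rw [← e1, ← e2, he]

lemma mf_choose (n m k₀ k₁ : ℕ) (hm : m ≤ n) (h1 : k₁ ≤ m) (h0 : k₀ ≤ n - m) :
    n.choose m * (m.descFactorial k₁ * (n - m).descFactorial k₀)
      = (n - (k₀ + k₁)).choose (m - k₁) * n.descFactorial (k₀ + k₁) := by
  have e1 := Nat.choose_mul_factorial_mul_factorial hm
  have e2 := Nat.choose_mul_factorial_mul_factorial
    (n := n - (k₀ + k₁)) (k := m - k₁) (by omega)
  have e3 := Nat.factorial_mul_descFactorial (n := n) (k := k₀ + k₁) (by omega)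
  have e4 := Nat.factorial_mul_descFactorial h1
  have e5 := Nat.factorial_mul_descFactorial h0
  have e6 : n - (k₀ + k₁) - (m - k₁) = n - m - k₀ := by omega
  rw [e6] at e2
  have hpos : 0 < (m - k₁).factorial * (n - m - k₀).factorial := by positivity
  apply Nat.eq_of_mul_eq_mul_right hpos
  calc _ = n.choose m * ((m - k₁).factorial * m.descFactorial k₁)
        * ((n - m - k₀).factorial * (n - m).descFactorial k₀) := by ring
    _ = n.factorial := by rw [e4, e5, e1]
    _ = ((n - (k₀ + k₁)).choose (m - k₁) * (m - k₁).factorial * (n - m - k₀).factorial)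
        * n.descFactorial (k₀ + k₁) := by rw [e2, e3]
    _ = _ := by ring

lemma mf_cond (k n : ℕ) (a : ℝ) (ha : 0 < a) (hk : 4 / a ≤ k) (hk1 : 1 ≤ k) (hn : k ^ 4 ≤ n)
    (j : ℕ) (hj : j ≤ k) : 2 * (j : ℝ) * (j + 1) ≤ a * n := by
  have h1 : (1 : ℝ) ≤ k := by exact_mod_cast hk1
  have h2 : (k : ℝ) ^ 4 ≤ n := by exact_mod_cast hn
  have h3 : (j : ℝ) ≤ k := by exact_mod_cast hj
  have h0 : (0 : ℝ) ≤ j := Nat.cast_nonneg j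
  rw [div_le_iff₀ ha] at hk
  have h4 : 4 ≤ a * (k : ℝ) ^ 2 := by nlinarith
  calc 2 * (j : ℝ) * (j + 1) ≤ 2 * k * (k + k) := by gcongr
    _ = 4 * (k : ℝ) ^ 2 := by ring
    _ ≤ a * (k : ℝ) ^ 2 * (k : ℝ) ^ 2 := by gcongr
    _ = a * (k : ℝ) ^ 4 := by ring
    _ ≤ a * n := by gcongr

/-- For every `0 < α < 1` there are `C > 0` and `K` such that for all `k₀, k₁` with
`k := k₀ + k₁ ≥ K` and all `n ≥ k⁴`, there is an `(n,k₀,k₁,α,1)`-mapping family of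
size at most `(1/(1−α))^{k₀}·(1/α)^{k₁}·(k·ln n)^{C·√k}`. -/
theorem mapping_family_alpha_one (α : ℝ) (hα0 : 0 < α) (hα1 : α < 1) :
    ∃ C : ℝ, 0 < C ∧ ∃ K : ℕ, ∀ k₀ k₁ : ℕ, K ≤ k₀ + k₁ →
      ∀ n : ℕ, (k₀ + k₁) ^ 4 ≤ n →
      ∃ F : Finset (Fin n → Fin 2),
        IsMappingFamily n k₀ k₁ α 1 F ∧
          (F.card : ℝ) ≤
            (1 / (1 - α)) ^ k₀ * (1 / α) ^ k₁ *
              (((k₀ + k₁ : ℕ) : ℝ) * Real.log n) ^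
                (C * Real.sqrt ((k₀ + k₁ : ℕ) : ℝ)) := by
  classical
  have hβ : 0 < 1 - α := by linarith
  refine ⟨2, by norm_num, ⌈4 / α + 4 / (1 - α)⌉₊ + 5, ?_⟩
  intro k₀ k₁ hK n hn
  have hk5 : 5 ≤ k₀ + k₁ := by omega
  have hkR : 4 / α + 4 / (1 - α) ≤ ((k₀ + k₁ : ℕ) : ℝ) :=
    (Nat.le_ceil _).trans (by exact_mod_cast (by omega))
  have p1 : 0 < 4 / α := by positivity
  have p2 : 0 < 4 / (1 - α) := by positivity
  have hn5 : 5 ≤ n := by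
    refine le_trans ?_ hn
    exact hk5.trans (Nat.le_self_pow (by norm_num) _)
  have hnR : (0 : ℝ) < n := by exact_mod_cast (by omega : 0 < n)
  set m := ⌈α * (n : ℝ)⌉₊ with hm
  have hmn : m ≤ n := by
    apply Nat.ceil_le.2; nlinarith
  have hm1 : α * n ≤ m := Nat.le_ceil _
  have hm2 : (m : ℝ) < α * n + 1 := Nat.ceil_lt_add_one (by positivity)
  obtain ⟨hk1m, hd1⟩ := mf_desc_lower m k₁ (α * n) (by positivity) (by linarith)
    (mf_cond (k₀ + k₁) n α hα0 (by linarith) (by omega) hn k₁ (by omega))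
  obtain ⟨hk0m, hd0⟩ := mf_desc_lower (n - m) k₀ ((1 - α) * n) (by positivity)
    (by rw [Nat.cast_sub hmn]; linarith)
    (mf_cond (k₀ + k₁) n (1 - α) hβ (by linarith) (by omega) hn k₀ (by omega))
  set p : ℝ := (1 - α) ^ k₀ * α ^ k₁ / 4 with hp
  have hp0 : 0 < p := by positivity
  have hprob : p * n.choose m ≤ ((n - (k₀ + k₁)).choose (m - k₁) : ℝ) := by
    have e : (n.choose m : ℝ) * (m.descFactorial k₁ * (n - m).descFactorial k₀)
      = (n - (k₀ + k₁)).choose (m - k₁) * n.descFactorial (k₀ + k₁) := by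
      exact_mod_cast mf_choose n m k₀ k₁ hmn hk1m hk0m
    have hD : (n.descFactorial (k₀ + k₁) : ℝ) ≤ (n : ℝ) ^ (k₀ + k₁) := by
      exact_mod_cast Nat.descFactorial_le_pow n (k₀ + k₁)
    have hpos : (0 : ℝ) < (n : ℝ) ^ (k₀ + k₁) := by positivity
    refine le_of_mul_le_mul_right ?_ hpos
    calc p * n.choose m * (n : ℝ) ^ (k₀ + k₁)
        = n.choose m * ((α * n) ^ k₁ / 2 * (((1 - α) * n) ^ k₀ / 2)) := by
          rw [hp, mul_pow, mul_pow, pow_add]; ring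
      _ ≤ n.choose m * (m.descFactorial k₁ * (n - m).descFactorial k₀) := by
          gcongr
      _ = _ := e
      _ ≤ _ := by gcongr
  set X : ℝ := ((k₀ + k₁ : ℕ) : ℝ) * Real.log n with hX
  set t : ℕ := ⌊X / p⌋₊ + 1 with ht
  set Q : Finset (Finset (Fin n) × Finset (Fin n)) :=
    ((powersetCard k₀ univ) ×ˢ (powersetCard k₁ univ)).filter (fun q => Disjoint q.1 q.2) with hQ
  have hlog : 1 ≤ Real.log n := by
    rw [Real.le_log_iff_exp_le hnR]
    have := Real.exp_one_lt_three
    have : (5 : ℝ) ≤ n := by exact_mod_cast hn5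
    linarith
  have hk5R : (5 : ℝ) ≤ ((k₀ + k₁ : ℕ) : ℝ) := by exact_mod_cast hk5
  have hX5 : 5 ≤ X := by rw [hX]; nlinarith
  have hQc : (Q.card : ℝ) ≤ Real.exp X := by
    have h1 : Q.card ≤ n ^ (k₀ + k₁) := by
      refine (Finset.card_filter_le _ _).trans ?_
      rw [card_product, card_powersetCard, card_powersetCard, pow_add]
      simp only [card_univ, Fintype.card_fin]
      exact Nat.mul_le_mul (Nat.choose_le_pow _ _) (Nat.choose_le_pow _ _)
    have h2 : Real.exp X = (n : ℝ) ^ (k₀ + k₁) := by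
      rw [hX, Real.exp_nat_mul, Real.exp_log hnR]
    rw [h2]; exact_mod_cast h1
  have hΩc : (powersetCard m (univ : Finset (Fin n))).card = n.choose m := by
    simp
  obtain ⟨G, hG, hGc, hGu⟩ := mf_greedy (powersetCard m (univ : Finset (Fin n)))
    (fun A (q : Finset (Fin n) × Finset (Fin n)) => Disjoint q.1 A ∧ q.2 ⊆ A) p Q
    (by rw [← card_pos, hΩc]; exact Nat.choose_pos hmn)
    (by
      rintro ⟨S₀, S₁⟩ hq
      simp only [hQ, mem_filter, mem_product, mem_powersetCard] at hq
      rw [hΩc]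
      refine hprob.trans ?_
      exact_mod_cast mf_count n m k₀ k₁ hk1m S₀ S₁ hq.2 hq.1.1.2 hq.1.2.2) t
  have hlt : (Q.card : ℝ) * Real.exp (-p) ^ t < 1 := by
    have h1 : X / p < t := by rw [ht]; push_cast; exact Nat.lt_floor_add_one _
    rw [div_lt_iff₀ hp0] at h1
    calc (Q.card : ℝ) * Real.exp (-p) ^ t ≤ Real.exp X * Real.exp (-p) ^ t := by gcongr
      _ = Real.exp (X + t * (-p)) := by rw [Real.exp_add, Real.exp_nat_mul (-p) t]
      _ < 1 := by rw [Real.exp_lt_one_iff]; linarith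
  have hcov : ∀ q ∈ Q, ∃ a ∈ G, Disjoint q.1 a ∧ q.2 ⊆ a := by
    intro q hq
    by_contra hcon
    push Not at hcon
    have h1 := hGu.trans_lt hlt
    refine eq_empty_iff_forall_notMem.1 (card_eq_zero.1 (Nat.cast_lt_one.1 h1)) q ?_
    refine (@mem_filter _ _ (_) _ _).2 ⟨hq, ?_⟩
    exact fun a ha h => hcon a ha h.1 h.2
  refine ⟨G.image fun A x => if x ∈ A then 1 else 0, ⟨?_, ?_⟩, ?_⟩
  · intro f hf
    obtain ⟨A, hA, rfl⟩ := mem_image.1 hf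
    have := (mem_powersetCard.1 (hG hA)).2
    simpa using this
  · intro S₀ S₁ hd h0 h1
    have hq : (S₀, S₁) ∈ Q := by
      simp [hQ, h0, h1, hd]
    obtain ⟨A, hA, hdA, hsA⟩ := hcov _ hq
    refine ⟨_, mem_image_of_mem _ hA, ?_, ?_⟩
    · intro x hx
      have : x ∉ A := fun h => (disjoint_left.1 hdA hx) h
      simp [this]
    · rw [one_mul, Nat.ceil_natCast, ← h1]
      congr 1
      apply filter_true_of_mem
      intro x hx
      simp [hsA hx]
  · have hc : ((G.image fun A (x : Fin n) => if x ∈ A then (1 : Fin 2) else 0).card : ℝ) ≤ t := by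
      exact_mod_cast card_image_le.trans hGc
    refine hc.trans ?_
    set B : ℝ := (1 / (1 - α)) ^ k₀ * (1 / α) ^ k₁ with hB
    have hB1 : 1 ≤ B := by
      have a1 : 1 ≤ 1 / (1 - α) := by rw [le_div_iff₀ hβ]; linarith
      have a2 : 1 ≤ 1 / α := by rw [le_div_iff₀ hα0]; linarith
      exact one_le_mul_of_one_le_of_one_le (one_le_pow₀ a1) (one_le_pow₀ a2)
    have hXp : X / p = 4 * B * X := by
      rw [hp, hB, one_div_pow, one_div_pow]; field_simp
    have h1 : (t : ℝ) ≤ X / p + 1 := by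
      rw [ht]; push_cast
      have := Nat.floor_le (a := X / p) (by positivity)
      linarith
    have h2 : X ^ (2 : ℝ) ≤ X ^ (2 * Real.sqrt ((k₀ + k₁ : ℕ) : ℝ)) := by
      apply Real.rpow_le_rpow_of_exponent_le (by linarith)
      have : 1 ≤ Real.sqrt ((k₀ + k₁ : ℕ) : ℝ) := Real.one_le_sqrt.2 (by linarith)
      linarith
    rw [Real.rpow_two] at h2
    calc (t : ℝ) ≤ 4 * B * X + 1 := by rw [← hXp]; exact h1
      _ ≤ B * (5 * X) := by nlinarith
      _ ≤ B * X ^ 2 := by gcongr; nlinarith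
      _ ≤ _ := by gcongr
end
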